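/- Let p, q be positive integers and let f: H_p -> H_p, g: H_q -> H_q, h: H_{p+q} -> H_{p+q} be K-linear maps such that h(ww') = f(w)g(w') for all monomials w in M_p and w' in M_q. Let z in P_{p+q} with z = uv, u in P_p, v in P_q. If h(z(n1,...,n6)) lies in h(S(z)) for all n1,...,n6 with n1+...+n6 = p+q, then either f(u(p1,...,p6)) lies in f(S(u)) for all p1,...,p6 with p1+...+p6 = p, or g(v(q1,...,q6)) lies in g(S(v)) for all q1,...,q6 with q1+...+q6 = q. (Here h(S(z)), f(S(u)), g(S(v)) denote the images, which are K-subspaces.) -/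

import Mathlib

open scoped Classical BigOperators

noncomputable section

/-- The free associative unital `K`-algebra on six generators `x1 x2 x3 y1 y2 y3`,
realized as the monoid algebra of the free monoid on six letters. -/
abbrev FreeA (K : Type) [Field K] : Type := MonoidAlgebra K (FreeMonoid (Fin 6))

/-- The map sending the generators `x1 x2 x3` to `x` and `y1 y2 y3` to `y`. -/
def bf : Fin 6 → Fin 2 := fun i => if (i : ℕ) < 3 then 0 else 1

/-- The monoid homomorphism `β` from monomials in six letters to monomials in two letters. -/
def bm : FreeMonoid (Fin 6) →* FreeMonoid (Fin 2) := FreeMonoid.map bf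

/-- Degree (length) of a monomial. -/
def len {α : Type} (w : FreeMonoid α) : ℕ := (FreeMonoid.toList w).length

/-- The ordering `≺` on monomials in `x, y`: same degree and lexicographically smaller. -/
def prec (z z' : FreeMonoid (Fin 2)) : Prop :=
  len z = len z' ∧ List.Lex (· < ·) (FreeMonoid.toList z) (FreeMonoid.toList z')

/-- The finite set of monomials of degree `n` in six letters. -/
def wordsOf (n : ℕ) : Finset (FreeMonoid (Fin 6)) :=
  (Finset.univ : Finset (Fin n → Fin 6)).image fun f => FreeMonoid.ofList (List.ofFn f)

/-- `wComp K z n` is `z(n₁,…,n₆)`: the sum of all monomials `v` (in six letters) with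
`β v = z` and with exactly `nᵢ` occurrences of the `i`-th generator; it is `0` if no such
monomial exists (in particular if some `nᵢ` is negative). -/
def wComp (K : Type) [Field K] (z : FreeMonoid (Fin 2)) (n : Fin 6 → ℤ) : FreeA K :=
  ∑ v ∈ (wordsOf (len z)).filter
      (fun v => bm v = z ∧ ∀ e : Fin 6, ((FreeMonoid.toList v).count e : ℤ) = n e),
    MonoidAlgebra.single v 1

/-- `H_i`: the `K`-span of the monomials of degree `i`. -/
def Hgr (K : Type) [Field K] (i : ℕ) : Submodule K (FreeA K) :=
  Submodule.span K {a | ∃ w : FreeMonoid (Fin 6), len w = i ∧ a = MonoidAlgebra.single w (1 : K)}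

/-- `S(z)` for `z` a monomial in `x, y`: the span of the monomials `w` in six letters of the
same degree with `β w ≺ z`.  (For a monomial `z` in six letters, `S(z) = SP K (bm z)`.) -/
def SP (K : Type) [Field K] (z : FreeMonoid (Fin 2)) : Submodule K (FreeA K) :=
  Submodule.span K
    {a | ∃ w : FreeMonoid (Fin 6), len w = len z ∧ prec (bm w) z ∧
      a = MonoidAlgebra.single w (1 : K)}

/-- `Q(z)`: the span of the monomials `w` of the same degree with `β w = z`. -/
def QP (K : Type) [Field K] (z : FreeMonoid (Fin 2)) : Submodule K (FreeA K) :=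
  Submodule.span K
    {a | ∃ w : FreeMonoid (Fin 6), len w = len z ∧ bm w = z ∧
      a = MonoidAlgebra.single w (1 : K)}

end

/-- The vector of multiplicities of the six generators in a monomial. -/
noncomputable def occ (w : FreeMonoid (Fin 6)) : Fin 6 → ℤ :=
  fun e => ((FreeMonoid.toList w).count e : ℤ)

/-- The finite set of monomials lying over a monomial in two letters. -/
noncomputable def fiber (z : FreeMonoid (Fin 2)) : Finset (FreeMonoid (Fin 6)) :=
  (wordsOf (len z)).filter fun w => bm w = z

theorem len_mul {α : Type} (w w' : FreeMonoid α) : len (w * w') = len w + len w' := by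
  simp [len, FreeMonoid.toList_mul]

theorem len_bm (w : FreeMonoid (Fin 6)) : len (bm w) = len w := by
  simp [len, bm, FreeMonoid.toList_map]

theorem occ_mul (w w' : FreeMonoid (Fin 6)) : occ (w * w') = occ w + occ w' := by
  funext e
  simp [occ, FreeMonoid.toList_mul]

theorem sum_occ (w : FreeMonoid (Fin 6)) : ∑ i, occ w i = (len w : ℤ) := by
  have h := Multiset.sum_count_eq_card (s := Finset.univ)
    (m := (FreeMonoid.toList w : Multiset (Fin 6))) (fun _ _ => Finset.mem_univ _)
  simp only [Multiset.coe_count, Multiset.coe_card] at h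
  simp only [occ, len]
  exact_mod_cast h

theorem mem_wordsOf {n : ℕ} {w : FreeMonoid (Fin 6)} : w ∈ wordsOf n ↔ len w = n := by
  simp only [wordsOf, Finset.mem_image, Finset.mem_univ, true_and]
  constructor
  · rintro ⟨f, rfl⟩
    simp [len]
  · rintro rfl
    exact ⟨fun i => (FreeMonoid.toList w).get i, by simp [len]⟩

theorem mem_fiber {z : FreeMonoid (Fin 2)} {w : FreeMonoid (Fin 6)} :
    w ∈ fiber z ↔ bm w = z := by
  simp only [fiber, Finset.mem_filter, mem_wordsOf, and_iff_right_iff_imp]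
  rintro rfl
  exact (len_bm w).symm

theorem wComp_eq (K : Type) [Field K] (z : FreeMonoid (Fin 2)) (n : Fin 6 → ℤ) :
    wComp K z n = ∑ w ∈ (fiber z).filter (fun w => occ w = n), MonoidAlgebra.single w 1 := by
  unfold wComp fiber
  rw [Finset.filter_filter]
  simp only [funext_iff, occ]

theorem wComp_eq_zero (K : Type) [Field K] {z : FreeMonoid (Fin 2)} {n : Fin 6 → ℤ}
    (hn : n ∉ (fiber z).image occ) : wComp K z n = 0 := by
  rw [wComp_eq, Finset.filter_eq_empty_iff.2, Finset.sum_empty]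
  rintro w hw rfl
  exact hn (Finset.mem_image_of_mem occ hw)

theorem single_mem_Hgr (K : Type) [Field K] (w : FreeMonoid (Fin 6)) :
    (MonoidAlgebra.single w 1 : FreeA K) ∈ Hgr K (len w) :=
  Submodule.subset_span ⟨w, rfl, rfl⟩

theorem wComp_mem_Hgr (K : Type) [Field K] (z : FreeMonoid (Fin 2)) (n : Fin 6 → ℤ) :
    wComp K z n ∈ Hgr K (len z) := by
  refine Submodule.sum_mem _ fun w hw => ?_
  rw [← mem_wordsOf.1 (Finset.mem_filter.1 hw).1]
  exact single_mem_Hgr K w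

theorem exists_mul_eq_of_len {α : Type} {w : FreeMonoid α} {p q : ℕ} (hw : len w = p + q) :
    ∃ s t : FreeMonoid α, s * t = w ∧ len s = p ∧ len t = q := by
  refine ⟨FreeMonoid.ofList ((FreeMonoid.toList w).take p),
    FreeMonoid.ofList ((FreeMonoid.toList w).drop p), ?_, ?_, ?_⟩
  · rw [← FreeMonoid.ofList_append, List.take_append_drop, FreeMonoid.ofList_toList]
  · simp only [len, FreeMonoid.toList_ofList, List.length_take] at hw ⊢
    omega
  · simp only [len, FreeMonoid.toList_ofList, List.length_drop] at hw ⊢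
    omega

theorem mul_inj_of_len {α : Type} {s t u v : FreeMonoid α} (h : s * t = u * v)
    (hl : len s = len u) : s = u ∧ t = v :=
  List.append_inj h hl

theorem lex_of_append {α : Type} {r : α → α → Prop} {b d : List α} :
    ∀ {a c : List α}, a.length = c.length → List.Lex r (a ++ b) (c ++ d) →
      List.Lex r a c ∨ a = c ∧ List.Lex r b d
  | [], [], _, h => Or.inr ⟨rfl, h⟩
  | x :: a, y :: c, hl, h => by
    rw [List.cons_append, List.cons_append] at h
    cases h with
    | rel hr => exact Or.inl (List.Lex.rel hr)
    | cons h =>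
      rcases lex_of_append (by simpa using hl) h with h | ⟨rfl, hbd⟩
      · exact Or.inl (List.Lex.cons h)
      · exact Or.inr ⟨rfl, hbd⟩

theorem prec_of_mul {s t u v : FreeMonoid (Fin 2)} (hl : len s = len u)
    (h : prec (s * t) (u * v)) : prec s u ∨ s = u ∧ prec t v := by
  obtain ⟨hlen, hlex⟩ := h
  rw [len_mul, len_mul] at hlen
  rcases lex_of_append (r := (· < ·)) (a := FreeMonoid.toList s) (c := FreeMonoid.toList u) hl hlex
    with h | ⟨h, h'⟩
  · exact Or.inl ⟨hl, h⟩
  · exact Or.inr ⟨h, by omega, h'⟩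

/-- Components of a product are convolutions of components of the factors. -/
theorem wComp_mul (K : Type) [Field K] (u v : FreeMonoid (Fin 2)) (n : Fin 6 → ℤ) :
    wComp K (u * v) n = ∑ c ∈ (fiber u).image occ, wComp K u c * wComp K v (n - c) := by
  have hprod : ∑ c ∈ (fiber u).image occ, wComp K u c * wComp K v (n - c) =
      ∑ x ∈ fiber u, ∑ y ∈ (fiber v).filter (fun y => occ y = n - occ x),
        (MonoidAlgebra.single (x * y) 1 : FreeA K) := by
    rw [← Finset.sum_fiberwise_of_maps_to (s := fiber u) (t := (fiber u).image occ) (g := occ)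
      fun x hx => Finset.mem_image_of_mem occ hx]
    refine Finset.sum_congr rfl fun c _ => ?_
    rw [wComp_eq, wComp_eq, Finset.sum_mul_sum]
    refine Finset.sum_congr rfl fun x hx => ?_
    rw [(Finset.mem_filter.1 hx).2]
    refine Finset.sum_congr rfl fun y _ => ?_
    rw [MonoidAlgebra.single_mul_single, one_mul]
  rw [hprod, wComp_eq, Finset.sum_sigma']
  symm
  refine Finset.sum_bij (fun x _ => x.1 * x.2) ?_ ?_ ?_ ?_
  · rintro ⟨x, y⟩ h
    simp only [Finset.mem_sigma, Finset.mem_filter, mem_fiber] at h ⊢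
    obtain ⟨rfl, rfl, hy⟩ := h
    exact ⟨map_mul bm x y, by rw [occ_mul, hy, add_sub_cancel]⟩
  · rintro ⟨x, y⟩ h ⟨x', y'⟩ h' heq
    simp only [Finset.mem_sigma, Finset.mem_filter, mem_fiber] at h h'
    obtain ⟨rfl, rfl⟩ := mul_inj_of_len heq (by rw [← len_bm, h.1, ← h'.1, len_bm])
    rfl
  · intro w hw
    simp only [Finset.mem_filter, mem_fiber] at hw
    obtain ⟨s, t, rfl, hs, -⟩ := exists_mul_eq_of_len (w := w) (p := len u) (q := len v)
      (by rw [← len_bm, hw.1, len_mul])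
    rw [map_mul] at hw
    obtain ⟨hsu, htv⟩ := mul_inj_of_len hw.1 ((len_bm s).trans hs)
    refine ⟨⟨s, t⟩, ?_, rfl⟩
    simp only [Finset.mem_sigma, Finset.mem_filter, mem_fiber]
    exact ⟨hsu, htv, by rw [← hw.2, occ_mul, add_sub_cancel_left]⟩
  · intro _ _
    rfl

/-- Multiplication identifies `H_p ⊗ A` with a subspace of `A`, so that a pair of linear
functionals induces a functional on products. -/
theorem exists_functional_mul {K : Type} [Field K] (p : ℕ) (φ ψ : FreeA K →ₗ[K] K) :
    ∃ Φ : FreeA K →ₗ[K] K, ∀ a ∈ Hgr K p, ∀ b, Φ (a * b) = φ a * ψ b := by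
  let Φ : FreeA K →ₗ[K] K :=
    (Finsupp.linearCombination K fun w : FreeMonoid (Fin 6) =>
      φ (MonoidAlgebra.single (FreeMonoid.ofList ((FreeMonoid.toList w).take p)) 1) *
        ψ (MonoidAlgebra.single (FreeMonoid.ofList ((FreeMonoid.toList w).drop p)) 1)) ∘ₗ
      (MonoidAlgebra.coeffLinearEquiv K).toLinearMap
  refine ⟨Φ, fun a ha b => ?_⟩
  induction ha using Submodule.span_induction with
  | mem a h =>
    obtain ⟨w, rfl, rfl⟩ := h
    suffices h : Φ ∘ₗ LinearMap.mulLeft K (MonoidAlgebra.single w 1) =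
        φ (MonoidAlgebra.single w 1) • ψ from LinearMap.congr_fun h b
    refine MonoidAlgebra.lhom_ext' fun w' => LinearMap.ext_ring ?_
    simp [Φ, MonoidAlgebra.single_mul_single, len, FreeMonoid.toList_mul]
  | zero => simp
  | add a a' _ _ h h' => rw [add_mul, map_add, map_add, add_mul, h, h']
  | smul c a _ h => rw [smul_mul_assoc, map_smul, map_smul, h, smul_mul_assoc]

theorem map_mul_of_single {K : Type} [Field K] {p q : ℕ} {f g h : FreeA K →ₗ[K] FreeA K}
    (hmul : ∀ w w' : FreeMonoid (Fin 6), len w = p → len w' = q →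
      h (MonoidAlgebra.single (w * w') 1) =
        f (MonoidAlgebra.single w 1) * g (MonoidAlgebra.single w' 1))
    {a b : FreeA K} (ha : a ∈ Hgr K p) (hb : b ∈ Hgr K q) : h (a * b) = f a * g b := by
  induction ha using Submodule.span_induction with
  | mem a ha =>
    obtain ⟨w, hw, rfl⟩ := ha
    induction hb using Submodule.span_induction with
    | mem b hb =>
      obtain ⟨w', hw', rfl⟩ := hb
      rw [← hmul w w' hw hw', MonoidAlgebra.single_mul_single, one_mul]
    | zero => simp
    | add b b' _ _ h h' => rw [mul_add, map_add, map_add, mul_add, h, h']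
    | smul c b _ h => rw [mul_smul_comm, map_smul, map_smul, h, mul_smul_comm]
  | zero => simp
  | add a a' _ _ h h' => rw [add_mul, map_add, map_add, add_mul, h, h']
  | smul c a _ h => rw [smul_mul_assoc, map_smul, map_smul, h, smul_mul_assoc]

/-- Among the components of `z` that `f` does not send into `f(S(z))`, there is a
lexicographically largest one, and it is separated from `f(S(z))` by a functional. -/
theorem exists_maximal_component {K : Type} [Field K] {f : FreeA K →ₗ[K] FreeA K}
    {z : FreeMonoid (Fin 2)} {n : Fin 6 → ℤ}
    (hn : f (wComp K z n) ∉ Submodule.map f (SP K z)) :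
    ∃ a ∈ (fiber z).image occ, ∃ φ : FreeA K →ₗ[K] K, φ (f (wComp K z a)) ≠ 0 ∧
      (∀ s ∈ Submodule.map f (SP K z), φ s = 0) ∧
      ∀ c, toLex a < toLex c → φ (f (wComp K z c)) = 0 := by
  have hmem : ∀ c, f (wComp K z c) ∉ Submodule.map f (SP K z) → c ∈ (fiber z).image occ := by
    intro c hc
    by_contra h
    exact hc (by rw [wComp_eq_zero K h, map_zero]; exact Submodule.zero_mem _)
  obtain ⟨a, ha, hmax⟩ := Finset.exists_max_image
    (((fiber z).image occ).filter fun c => f (wComp K z c) ∉ Submodule.map f (SP K z)) toLex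
    ⟨n, Finset.mem_filter.2 ⟨hmem n hn, hn⟩⟩
  rw [Finset.mem_filter] at ha
  obtain ⟨φ, hφ, hker⟩ := Submodule.exists_le_ker_of_notMem ha.2
  refine ⟨a, ha.1, φ, hφ, fun s hs => hker hs, fun c hc => ?_⟩
  by_contra h
  have hc' : f (wComp K z c) ∉ Submodule.map f (SP K z) := fun hs => h (hker hs)
  exact (hmax c (Finset.mem_filter.2 ⟨hmem c hc', hc'⟩)).not_gt hc

/-- A functional induced by functionals vanishing on `f(S(u))` and `g(S(v))` vanishes
on `h(S(uv))`. -/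
theorem functional_eq_zero_of_mem_map_SP {K : Type} [Field K] {p q : ℕ}
    {f g h : FreeA K →ₗ[K] FreeA K} (hf : ∀ a ∈ Hgr K p, f a ∈ Hgr K p)
    (hmul : ∀ w w' : FreeMonoid (Fin 6), len w = p → len w' = q →
      h (MonoidAlgebra.single (w * w') 1) =
        f (MonoidAlgebra.single w 1) * g (MonoidAlgebra.single w' 1))
    {u v : FreeMonoid (Fin 2)} (hu : len u = p) (hv : len v = q) {φ ψ Φ : FreeA K →ₗ[K] K}
    (hφ : ∀ s ∈ Submodule.map f (SP K u), φ s = 0)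
    (hψ : ∀ s ∈ Submodule.map g (SP K v), ψ s = 0)
    (hΦ : ∀ a ∈ Hgr K p, ∀ b, Φ (a * b) = φ a * ψ b) {x : FreeA K}
    (hx : x ∈ Submodule.map h (SP K (u * v))) : Φ x = 0 := by
  suffices hle : Submodule.map h (SP K (u * v)) ≤ LinearMap.ker Φ from hle hx
  rw [Submodule.map_le_iff_le_comap, SP, Submodule.span_le]
  rintro _ ⟨w, hw, hlt, rfl⟩
  rw [len_mul, hu, hv] at hw
  obtain ⟨s, t, rfl, hs, ht⟩ := exists_mul_eq_of_len hw
  have hfs : f (MonoidAlgebra.single s 1) ∈ Hgr K p := hf _ (hs ▸ single_mem_Hgr K s)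
  change Φ (h (MonoidAlgebra.single (s * t) 1)) = 0
  rw [hmul s t hs ht, hΦ _ hfs]
  rw [map_mul] at hlt
  rcases prec_of_mul (by rw [len_bm, hs, hu]) hlt with hlt | ⟨-, hlt⟩
  · rw [hφ _ (Submodule.mem_map_of_mem
      (Submodule.subset_span ⟨s, hs.trans hu.symm, hlt, rfl⟩)), zero_mul]
  · rw [hψ _ (Submodule.mem_map_of_mem
      (Submodule.subset_span ⟨t, ht.trans hv.symm, hlt, rfl⟩)), mul_zero]


theorem stmt6 (K : Type) [Field K] (p q : ℕ) (hp : 0 < p) (hq : 0 < q)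
    (f g h : FreeA K →ₗ[K] FreeA K)
    (hf : ∀ a ∈ Hgr K p, f a ∈ Hgr K p)
    (hg : ∀ a ∈ Hgr K q, g a ∈ Hgr K q)
    (hh : ∀ a ∈ Hgr K (p + q), h a ∈ Hgr K (p + q))
    (hmul : ∀ w w' : FreeMonoid (Fin 6), len w = p → len w' = q →
      h (MonoidAlgebra.single (w * w') 1) =
        f (MonoidAlgebra.single w 1) * g (MonoidAlgebra.single w' 1))
    (u v : FreeMonoid (Fin 2)) (hu : len u = p) (hv : len v = q)
    (hz : ∀ n : Fin 6 → ℤ, (∑ i, n i) = ((p + q : ℕ) : ℤ) →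
      h (wComp K (u * v) n) ∈ Submodule.map h (SP K (u * v))) :
    (∀ n : Fin 6 → ℤ, (∑ i, n i) = (p : ℤ) →
      f (wComp K u n) ∈ Submodule.map f (SP K u)) ∨
    (∀ n : Fin 6 → ℤ, (∑ i, n i) = (q : ℤ) →
      g (wComp K v n) ∈ Submodule.map g (SP K v)) := by
  by_contra! hcon
  obtain ⟨⟨n, -, hn⟩, ⟨m, -, hm⟩⟩ := hcon
  obtain ⟨a, ha, φ, hφa, hφS, hφgt⟩ := exists_maximal_component hn
  obtain ⟨b, hb, ψ, hψb, hψS, hψgt⟩ := exists_maximal_component hm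
  obtain ⟨Φ, hΦ⟩ := exists_functional_mul p φ ψ
  have hsum : ∀ {z : FreeMonoid (Fin 2)} {c : Fin 6 → ℤ}, c ∈ (fiber z).image occ →
      ∑ i, c i = (len z : ℤ) := by
    intro z c hc
    obtain ⟨w, hw, rfl⟩ := Finset.mem_image.1 hc
    rw [sum_occ, ← len_bm, mem_fiber.1 hw]
  have hzero := functional_eq_zero_of_mem_map_SP hf hmul hu hv hφS hψS hΦ
    (hz (a + b) (by simp [Finset.sum_add_distrib, hsum ha, hsum hb, hu, hv]))
  have hterm : ∀ c d, Φ (h (wComp K u c * wComp K v d)) =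
      φ (f (wComp K u c)) * ψ (g (wComp K v d)) := by
    intro c d
    have huc : wComp K u c ∈ Hgr K p := hu ▸ wComp_mem_Hgr K u c
    have hvd : wComp K v d ∈ Hgr K q := hv ▸ wComp_mem_Hgr K v d
    rw [map_mul_of_single hmul huc hvd, hΦ _ (hf _ huc)]
  rw [wComp_mul, map_sum, map_sum, Finset.sum_eq_single_of_mem a ha, hterm,
    add_sub_cancel_left] at hzero
  · exact mul_ne_zero hφa hψb hzero
  · intro c _ hca
    rw [hterm]
    rcases lt_or_gt_of_ne (toLex.injective.ne hca) with hlt | hgt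
    · have hd : toLex b < toLex (a + b - c) := by
        have h1 : toLex (a + b - c) = toLex a + toLex b - toLex c := rfl
        rw [h1, lt_sub_iff_add_lt, add_comm]
        exact add_lt_add_left hlt _
      rw [hψgt _ hd, mul_zero]
    · rw [hφgt c hgt, zero_mul]
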